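/- arXiv:2406.02082 — 2 statements merged into one kernel-verified Lean document; each statement's English description precedes it below -/
import Mathlib

section
/- Let n ≥ 1 and let w satisfy the 2-dimensional recurrence with coefficients a, b, c. Define for each diagonal index d with 1 ≤ d ≤ 2n−1 the vector x_d ∈ ℝ^n, the vector k_d ∈ ℝ^n, and the matrix h_d ∈ ℝ^{n×n} as in the diagonal reduction. Then x_1 = k_1, and for every d with 2 ≤ d ≤ 2n−1 one has x_d = h_d x_{d−1} + k_d. That is, the 2-dimensional recurrence problem reduces to the mono-dimensional vector recurrence x_d = h_d x_{d−1} + k_d. -/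
/-- The diagonal vector `x_d ∈ ℝ^n` of the reduction: for `1 ≤ d ≤ n`,
`(x_d)_i = w(1+i, d−i)` for `0 ≤ i ≤ d−1` and `0` otherwise; for
`n+1 ≤ d ≤ 2n−1`, `(x_d)_i = w((d+1−n)+i, n−i)` for `0 ≤ i ≤ 2n−d−1` and `0` otherwise. -/
def xvec (n : ℕ) (w : ℕ → ℕ → ℝ) (d : ℕ) : Fin n → ℝ := fun i =>
  if d ≤ n then
    if i.val < d then w (1 + i.val) (d - i.val) else 0
  else
    if i.val < 2 * n - d then w (d + 1 - n + i.val) (n - i.val) else 0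

/-- The constant vector `k_d ∈ ℝ^n` of the reduction. -/
def kvec (n : ℕ) (a b c : ℕ → ℕ → ℝ) (d : ℕ) : Fin n → ℝ := fun i =>
  if d ≤ n then
    if d = 1 then
      if i.val = 0 then c 1 1 + a 1 1 * c 0 1 + b 1 1 * c 1 0 else 0
    else
      if i.val = 0 then c 1 d + a 1 d * c 0 d
      else if i.val = d - 1 then c d 1 + b d 1 * c d 0
      else if i.val < d then c (1 + i.val) (d - i.val)
      else 0
  else
    if i.val < 2 * n - d then c (d + 1 - n + i.val) (n - i.val) else 0

/-- The reduction matrix `h_d ∈ ℝ^{n×n}`: lower-bidiagonal for `2 ≤ d ≤ n`,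
upper-bidiagonal for `n+1 ≤ d ≤ 2n−1`. -/
def hmat (n : ℕ) (a b : ℕ → ℕ → ℝ) (d : ℕ) : Matrix (Fin n) (Fin n) ℝ := fun i j =>
  if d ≤ n then
    if i.val = 0 then
      if j.val = 0 then b 1 d else 0
    else if i.val = d - 1 then
      if j.val = d - 2 then a d 1 else 0
    else if i.val ≤ d - 2 then
      if j.val = i.val - 1 then a (1 + i.val) (d - i.val)
      else if j.val = i.val then b (1 + i.val) (d - i.val)
      else 0
    else 0
  else
    if i.val < 2 * n - d then
      if j.val = i.val then a (d + 1 - n + i.val) (n - i.val)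
      else if j.val = i.val + 1 then b (d + 1 - n + i.val) (n - i.val)
      else 0
    else 0

/-- A row vector supported in column `k` picks out the `k`-th coordinate. -/
theorem sum_ite_val_eq_mul {n : ℕ} (v : Fin n → ℝ) (k : Fin n) (α : ℝ) :
    ∑ j : Fin n, (if j.val = k.val then α else 0) * v j = α * v k := by
  simp [← Fin.ext_iff]

/-- A row vector supported in columns `k ≠ l` picks out the `k`-th and `l`-th coordinates. -/
theorem sum_ite_val_eq_ite_val_eq_mul {n : ℕ} (v : Fin n → ℝ) {k l : Fin n} (hkl : k ≠ l)
    (α β : ℝ) :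
    ∑ j : Fin n, (if j.val = k.val then α else if j.val = l.val then β else 0) * v j =
      α * v k + β * v l := by
  rw [← sum_ite_val_eq_mul v k, ← sum_ite_val_eq_mul v l, ← Finset.sum_add_distrib]
  refine Finset.sum_congr rfl fun j _ => ?_
  rw [ne_eq, Fin.ext_iff] at hkl
  split_ifs <;> first | omega | ring

section

variable {n : ℕ} {a b c w : ℕ → ℕ → ℝ}

theorem xvec_of_le {d : ℕ} (hd : d ≤ n) (i : Fin n) (hi : i.val < d) :
    xvec n w d i = w (1 + i.val) (d - i.val) := by
  simp [xvec, hd, hi]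

theorem xvec_of_ge {d : ℕ} (hd : n ≤ d) (i : Fin n) (hi : i.val < 2 * n - d) :
    xvec n w d i = w (d + 1 - n + i.val) (n - i.val) := by
  rcases hd.eq_or_lt with rfl | hd
  · rw [xvec_of_le le_rfl i i.isLt, Nat.add_sub_cancel_left]
  · simp [xvec, hd.not_ge, hi]

theorem hmat_mulVec_zero {d : ℕ} (hd : d ≤ n) (v : Fin n → ℝ) (i : Fin n) (hi : i.val = 0) :
    (hmat n a b d).mulVec v i = b 1 d * v i := by
  rw [← sum_ite_val_eq_mul v i]
  simp [Matrix.mulVec, dotProduct, hmat, hd, hi]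

theorem hmat_mulVec_last {d : ℕ} (hd2 : 2 ≤ d) (hd : d ≤ n) (v : Fin n → ℝ) (i : Fin n)
    (hi : i.val = d - 1) :
    (hmat n a b d).mulVec v i = a d 1 * v ⟨d - 2, by omega⟩ := by
  have hd0 : d - 1 ≠ 0 := by omega
  rw [← sum_ite_val_eq_mul v]
  simp only [Matrix.mulVec, dotProduct, hmat, hd, hi, hd0, if_true, if_false]

theorem hmat_mulVec_middle {d : ℕ} (hd : d ≤ n) (v : Fin n → ℝ) (i : Fin n)
    (hi0 : i.val ≠ 0) (hi : i.val < d - 1) :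
    (hmat n a b d).mulVec v i =
      a (1 + i.val) (d - i.val) * v ⟨i.val - 1, by omega⟩ +
        b (1 + i.val) (d - i.val) * v i := by
  have hi1 : i.val ≠ d - 1 := by omega
  have hi2 : i.val ≤ d - 2 := by omega
  rw [← sum_ite_val_eq_ite_val_eq_mul v (by rw [ne_eq, Fin.ext_iff]; dsimp only; omega)]
  simp only [Matrix.mulVec, dotProduct, hmat, hd, hi0, hi1, hi2, if_true, if_false]

theorem hmat_mulVec_of_lt {d : ℕ} (hd : n < d) (v : Fin n → ℝ) (i : Fin n)
    (hi : i.val < 2 * n - d) :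
    (hmat n a b d).mulVec v i =
      a (d + 1 - n + i.val) (n - i.val) * v i +
        b (d + 1 - n + i.val) (n - i.val) * v ⟨i.val + 1, by omega⟩ := by
  rw [← sum_ite_val_eq_ite_val_eq_mul v (by rw [ne_eq, Fin.ext_iff]; dsimp only; omega)]
  simp only [Matrix.mulVec, dotProduct, hmat, hd.not_ge, hi, if_true, if_false]

theorem xvec_one (hn : 1 ≤ n)
    (hrec : ∀ i j : ℕ, 1 ≤ i → i ≤ n → 1 ≤ j → j ≤ n →
      w i j = a i j * w (i - 1) j + b i j * w i (j - 1) + c i j)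
    (hbd1 : ∀ j : ℕ, 1 ≤ j → j ≤ n → w 0 j = c 0 j)
    (hbd2 : ∀ i : ℕ, 1 ≤ i → i ≤ n → w i 0 = c i 0) :
    xvec n w 1 = kvec n a b c 1 := by
  funext i
  by_cases hi : i.val = 0
  · simp only [xvec, kvec, hn, hi, if_true, zero_lt_one, add_zero, Nat.sub_zero]
    rw [hrec 1 1 le_rfl hn le_rfl hn, Nat.sub_self, hbd1 1 le_rfl hn, hbd2 1 le_rfl hn]
    ring
  · simp [xvec, kvec, hn, hi]

/-- The vector recurrence on the growing diagonals. -/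
theorem xvec_eq_of_le {d : ℕ} (hd2 : 2 ≤ d) (hd : d ≤ n)
    (hrec : ∀ i j : ℕ, 1 ≤ i → i ≤ n → 1 ≤ j → j ≤ n →
      w i j = a i j * w (i - 1) j + b i j * w i (j - 1) + c i j)
    (hbd1 : ∀ j : ℕ, 1 ≤ j → j ≤ n → w 0 j = c 0 j)
    (hbd2 : ∀ i : ℕ, 1 ≤ i → i ≤ n → w i 0 = c i 0) :
    xvec n w d = (hmat n a b d).mulVec (xvec n w (d - 1)) + kvec n a b c d := by
  funext i
  have hd1 : d ≠ 1 := by omega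
  rw [Pi.add_apply]
  rcases lt_or_ge i.val d with hid | hid
  · rw [xvec_of_le hd i hid, hrec _ _ (by omega) (by omega) (by omega) (by omega)]
    by_cases hi0 : i.val = 0
    · rw [hmat_mulVec_zero hd _ i hi0, xvec_of_le (by omega) i (by omega)]
      simp only [kvec, hd, hd1, hi0, if_true, if_false, add_zero, Nat.sub_zero, Nat.sub_self]
      rw [hbd1 d (by omega) hd]
      ring
    by_cases hi1 : i.val = d - 1
    · have hd0 : d - 1 ≠ 0 := by omega
      rw [hmat_mulVec_last hd2 hd _ i hi1, xvec_of_le (by omega) _ (by dsimp only; omega)]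
      simp only [kvec, hd, hd1, hi1, hd0, if_true, if_false]
      rw [show 1 + (d - 1) = d by omega, show d - (d - 1) = 1 by omega,
        show 1 + (d - 2) = d - 1 by omega, show d - 1 - (d - 2) = 1 by omega, Nat.sub_self,
        hbd2 d (by omega) hd]
      ring
    · rw [hmat_mulVec_middle hd _ i hi0 (by omega), xvec_of_le (by omega) i (by omega),
        xvec_of_le (by omega) _ (by dsimp only; omega)]
      simp only [kvec, hd, hd1, hi0, hi1, hid, if_true, if_false]
      rw [show 1 + (i.val - 1) = 1 + i.val - 1 by omega,
        show d - 1 - (i.val - 1) = d - i.val by omega,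
        show d - 1 - i.val = d - i.val - 1 by omega]
  · have hi0 : i.val ≠ 0 := by omega
    have hi1 : i.val ≠ d - 1 := by omega
    have hi2 : ¬ i.val ≤ d - 2 := by omega
    simp [xvec, kvec, Matrix.mulVec, dotProduct, hmat, hd, hd1, hi0, hi1, hi2, hid.not_gt]

/-- The vector recurrence on the shrinking diagonals. -/
theorem xvec_eq_of_lt {d : ℕ} (hd : n < d)
    (hrec : ∀ i j : ℕ, 1 ≤ i → i ≤ n → 1 ≤ j → j ≤ n →
      w i j = a i j * w (i - 1) j + b i j * w i (j - 1) + c i j) :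
    xvec n w d = (hmat n a b d).mulVec (xvec n w (d - 1)) + kvec n a b c d := by
  funext i
  rw [Pi.add_apply]
  by_cases hi : i.val < 2 * n - d
  · rw [xvec_of_ge hd.le i hi, hrec _ _ (by omega) (by omega) (by omega) (by omega),
      hmat_mulVec_of_lt hd _ i hi, xvec_of_ge (by omega) i (by omega),
      xvec_of_ge (by omega) _ (by dsimp only; omega)]
    simp only [kvec, hd.not_ge, hi, if_true, if_false]
    rw [show d - 1 + 1 - n + i.val = d + 1 - n + i.val - 1 by omega,
      show d - 1 + 1 - n + (i.val + 1) = d + 1 - n + i.val by omega,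
      show n - (i.val + 1) = n - i.val - 1 by omega]
  · simp [xvec, kvec, Matrix.mulVec, dotProduct, hmat, hd.not_ge, hi]

end

/-- If `w` satisfies the 2-dimensional recurrence, then the diagonal
reduction satisfies the mono-dimensional vector recurrence `x_1 = k_1` and
`x_d = h_d x_{d−1} + k_d` for `2 ≤ d ≤ 2n−1`. -/
theorem two_dim_recurrence_reduces_to_one_dim
    (n : ℕ) (hn : 1 ≤ n) (a b c w : ℕ → ℕ → ℝ)
    (hrec : ∀ i j : ℕ, 1 ≤ i → i ≤ n → 1 ≤ j → j ≤ n →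
      w i j = a i j * w (i - 1) j + b i j * w i (j - 1) + c i j)
    (hbd1 : ∀ j : ℕ, 1 ≤ j → j ≤ n → w 0 j = c 0 j)
    (hbd2 : ∀ i : ℕ, 1 ≤ i → i ≤ n → w i 0 = c i 0) :
    xvec n w 1 = kvec n a b c 1 ∧
    ∀ d : ℕ, 2 ≤ d → d ≤ 2 * n - 1 →
      xvec n w d = (hmat n a b d).mulVec (xvec n w (d - 1)) + kvec n a b c d := by
  refine ⟨xvec_one hn hrec hbd1 hbd2, fun d hd2 _ => ?_⟩
  rcases le_or_gt d n with hd | hd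
  · exact xvec_eq_of_le hd2 hd hrec hbd1 hbd2
  · exact xvec_eq_of_lt hd hrec
end

section
/- Let n ≥ 2 and let w satisfy the 2-dimensional recurrence with coefficients a, b, c. Then for every d with 2 ≤ d ≤ n, the diagonal vector x_d ∈ ℝ^n satisfies x_d = h_d x_{d−1} + k_d, where x_{d−1}, h_d, k_d are given by the diagonal reduction for the lower-triangular range of diagonals. -/
theorem xvec_apply_of_lt {n d : ℕ} (w : ℕ → ℕ → ℝ) (hdn : d ≤ n) {i : Fin n} (hi : i.val < d) :
    xvec n w d i = w (1 + i.val) (d - i.val) := by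
  simp [xvec, hdn, hi]

theorem xvec_apply_of_le {n d : ℕ} (w : ℕ → ℕ → ℝ) (hdn : d ≤ n) {i : Fin n} (hi : d ≤ i.val) :
    xvec n w d i = 0 := by
  simp [xvec, hdn, hi]

theorem hmat_row_first {n d : ℕ} (a b : ℕ → ℕ → ℝ) (hdn : d ≤ n) {i : Fin n} (hi : i.val = 0) :
    hmat n a b d i = Pi.single i (b 1 d) := by
  ext j
  simp [hmat, hdn, hi, Pi.single_apply, Fin.ext_iff]

theorem hmat_row_middle {n d : ℕ} (a b : ℕ → ℕ → ℝ) (hdn : d ≤ n) {p i : Fin n}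
    (hp : i.val = p.val + 1) (hi : i.val < d - 1) :
    hmat n a b d i =
      Pi.single p (a (1 + i.val) (d - i.val)) + Pi.single i (b (1 + i.val) (d - i.val)) := by
  ext j
  have hne : i.val ≠ d - 1 := by lia
  have hle : i.val ≤ d - 2 := by lia
  have h0 : i.val ≠ 0 := by lia
  have hsub : i.val - 1 = p.val := by lia
  simp only [hmat, Pi.add_apply, Pi.single_apply, Fin.ext_iff, if_pos hdn, if_neg h0, if_neg hne,
    if_pos hle, hsub]
  by_cases hj : j.val = p.val
  · rw [if_pos hj, if_pos hj, if_neg (by lia), add_zero]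
  · rw [if_neg hj, if_neg hj, zero_add]

theorem hmat_row_last {n d : ℕ} (a b : ℕ → ℕ → ℝ) (hdn : d ≤ n) {p i : Fin n}
    (hp : i.val = p.val + 1) (hi : i.val = d - 1) :
    hmat n a b d i = Pi.single p (a d 1) := by
  ext j
  have h0 : i.val ≠ 0 := by lia
  have hsub : d - 2 = p.val := by lia
  simp only [hmat, Pi.single_apply, Fin.ext_iff, if_pos hdn, if_neg h0, if_pos hi, hsub]

theorem hmat_row_of_le {n d : ℕ} (a b : ℕ → ℕ → ℝ) (hd : 2 ≤ d) (hdn : d ≤ n) {i : Fin n}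
    (hi : d ≤ i.val) : hmat n a b d i = 0 := by
  ext j
  have h0 : i.val ≠ 0 := by lia
  have hne : i.val ≠ d - 1 := by lia
  have hle : ¬ i.val ≤ d - 2 := by lia
  simp only [hmat, Pi.zero_apply, if_pos hdn, if_neg h0, if_neg hne, if_neg hle]

theorem kvec_apply_first {n d : ℕ} (a b c : ℕ → ℕ → ℝ) (hd : 2 ≤ d) (hdn : d ≤ n) {i : Fin n}
    (hi : i.val = 0) : kvec n a b c d i = c 1 d + a 1 d * c 0 d := by
  have h1 : d ≠ 1 := by lia
  simp only [kvec, if_pos hdn, if_neg h1, if_pos hi]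

theorem kvec_apply_middle {n d : ℕ} (a b c : ℕ → ℕ → ℝ) (hdn : d ≤ n) {i : Fin n}
    (h0 : i.val ≠ 0) (hi : i.val < d - 1) :
    kvec n a b c d i = c (1 + i.val) (d - i.val) := by
  have h1 : d ≠ 1 := by lia
  have hlt : i.val < d := by lia
  simp only [kvec, if_pos hdn, if_neg h1, if_neg h0, if_neg hi.ne, if_pos hlt]

theorem kvec_apply_last {n d : ℕ} (a b c : ℕ → ℕ → ℝ) (hd : 2 ≤ d) (hdn : d ≤ n) {i : Fin n}
    (hi : i.val = d - 1) : kvec n a b c d i = c d 1 + b d 1 * c d 0 := by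
  have h1 : d ≠ 1 := by lia
  have h0 : i.val ≠ 0 := by lia
  simp only [kvec, if_pos hdn, if_neg h1, if_neg h0, if_pos hi]

theorem kvec_apply_of_le {n d : ℕ} (a b c : ℕ → ℕ → ℝ) (hd : 2 ≤ d) (hdn : d ≤ n) {i : Fin n}
    (hi : d ≤ i.val) : kvec n a b c d i = 0 := by
  have h1 : d ≠ 1 := by lia
  have h0 : i.val ≠ 0 := by lia
  have hne : i.val ≠ d - 1 := by lia
  simp only [kvec, if_pos hdn, if_neg h1, if_neg h0, if_neg hne, if_neg hi.not_gt]

/-- For `2 ≤ d ≤ n` (lower-triangular range of diagonals),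
`x_d = h_d x_{d−1} + k_d`. -/
theorem diag_recurrence_lower_range
    (n : ℕ) (hn : 2 ≤ n) (a b c w : ℕ → ℕ → ℝ)
    (hrec : ∀ i j : ℕ, 1 ≤ i → i ≤ n → 1 ≤ j → j ≤ n →
      w i j = a i j * w (i - 1) j + b i j * w i (j - 1) + c i j)
    (hbd1 : ∀ j : ℕ, 1 ≤ j → j ≤ n → w 0 j = c 0 j)
    (hbd2 : ∀ i : ℕ, 1 ≤ i → i ≤ n → w i 0 = c i 0) :
    ∀ d : ℕ, 2 ≤ d → d ≤ n →
      xvec n w d = (hmat n a b d).mulVec (xvec n w (d - 1)) + kvec n a b c d := by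
  intro d hd hdn
  ext i
  simp only [Pi.add_apply, Matrix.mulVec]
  have hdn' : d - 1 ≤ n := by lia
  obtain h0 | h0 := Nat.eq_zero_or_pos i.val
  · have hw := hrec 1 d le_rfl (by lia) (by lia) hdn
    rw [Nat.sub_self, hbd1 d (by lia) hdn] at hw
    rw [hmat_row_first a b hdn h0, single_dotProduct, xvec_apply_of_lt w hdn (by lia),
      xvec_apply_of_lt w hdn' (by lia), kvec_apply_first a b c hd hdn h0, h0]
    simp only [add_zero, Nat.sub_zero]
    linarith
  · obtain ⟨p, hp⟩ : ∃ p : Fin n, i.val = p.val + 1 :=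
      ⟨⟨i.val - 1, by lia⟩, (Nat.sub_add_cancel h0).symm⟩
    obtain hi | hi | hi := lt_trichotomy i.val (d - 1)
    · have hw := hrec (1 + i.val) (d - i.val) (by lia) (by lia) (by lia) (by lia)
      rw [hmat_row_middle a b hdn hp hi, add_dotProduct, single_dotProduct, single_dotProduct,
        xvec_apply_of_lt w hdn (by lia), xvec_apply_of_lt w hdn' (by lia),
        xvec_apply_of_lt w hdn' hi, kvec_apply_middle a b c hdn h0.ne' hi, hw,
        show 1 + i.val - 1 = 1 + p.val by lia, show d - 1 - p.val = d - i.val by lia,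
        Nat.sub_right_comm]
    · have hw := hrec d 1 (by lia) hdn le_rfl (by lia)
      rw [Nat.sub_self, hbd2 d (by lia) hdn] at hw
      rw [hmat_row_last a b hdn hp hi, single_dotProduct, xvec_apply_of_lt w hdn (by lia),
        xvec_apply_of_lt w hdn' (by lia), kvec_apply_last a b c hd hdn hi,
        show 1 + i.val = d by lia, show d - i.val = 1 by lia,
        show 1 + p.val = d - 1 by lia, show d - 1 - p.val = 1 by lia]
      linarith
    · have hle : d ≤ i.val := by lia
      rw [hmat_row_of_le a b hd hdn hle, zero_dotProduct, xvec_apply_of_le w hdn hle,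
        kvec_apply_of_le a b c hd hdn hle, add_zero]
end
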